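/- arXiv:2208.00668 — 3 statements merged into one kernel-verified Lean document; each statement's English description precedes it below -/
import Mathlib

section
/- Let f : X → X be a continuous self-map of a Noetherian Priestley space X. Then the topological entropy of f is 0. -/
open Set Filter
open scoped ENNReal

variable {X : Type*}

/-- `dynN f U n` is the complexity `N(𝔘ₙ)` of the joint cover
`𝔘ₙ = 𝔘 ∨ f⁻¹𝔘 ∨ ⋯ ∨ f⁻⁽ⁿ⁻¹⁾𝔘`. -/
noncomputable def dynN (f : X → X) (U : Finset (Set X)) (n : ℕ) : ℕ :=
  sInf {m : ℕ | ∃ c : Fin m → Fin n → Set X,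
    (∀ (j : Fin m) (i : Fin n), c j i ∈ U) ∧
      (⋃ j : Fin m, ⋂ i : Fin n, f^[(i : ℕ)] ⁻¹' c j i) = Set.univ}

/-- Topological entropy defined via finite open covers. -/
noncomputable def coverEntropy [TopologicalSpace X] (f : X → X) : ℝ≥0∞ :=
  ⨆ (U : Finset (Set X)) (_ : ∀ u ∈ U, IsOpen u) (_ : ⋃₀ (U : Set (Set X)) = Set.univ),
    Filter.limsup (fun n : ℕ => ENNReal.ofReal (Real.log (dynN f U n)) / (n : ℝ≥0∞))
      Filter.atTop

/-! ### Noetherian Priestley spaces are scattered -/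

section Priestley

variable [TopologicalSpace X] [PartialOrder X]

theorem wellFounded_closed_lowerSets
    (hnoeth : ∀ C : ℕ → Set X, (∀ n, IsClosed (C n) ∧ IsLowerSet (C n)) →
      (∀ n, C (n + 1) ⊆ C n) → ∃ N, ∀ n ≥ N, C n = C N) :
    WellFounded (fun C D : {C : Set X // IsClosed C ∧ IsLowerSet C} => C < D) := by
  rw [RelEmbedding.wellFounded_iff_isEmpty]
  refine ⟨fun g => ?_⟩
  have hlt : ∀ n, g (n + 1) < g n := fun n => g.map_rel_iff.2 (Nat.lt_succ_self n)
  obtain ⟨N, hN⟩ := hnoeth (fun n => (g n).1) (fun n => (g n).2) (fun n => (hlt n).le)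
  exact (hlt N).ne (Subtype.ext (hN (N + 1) (Nat.le_succ N)))

/-- A closed lower set of a Priestley space is separated from points outside it by a clopen
lower set. -/
theorem exists_isClopen_isLowerSet_superset [CompactSpace X]
    (hpriest : ∀ x y : X, ¬ y ≤ x →
      ∃ U : Set X, IsClopen U ∧ IsLowerSet U ∧ x ∈ U ∧ y ∉ U)
    {D : Set X} (hD : IsClosed D) (hlow : IsLowerSet D) {y : X} (hy : y ∉ D) :
    ∃ U : Set X, IsClopen U ∧ IsLowerSet U ∧ D ⊆ U ∧ y ∉ U := by
  have hsep : ∀ x ∈ D, ∃ U : Set X, IsClopen U ∧ IsLowerSet U ∧ x ∈ U ∧ y ∉ U :=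
    fun x hx => hpriest x y fun hyx => hy (hlow hyx hx)
  choose! V hV hVlow hxV hyV using hsep
  obtain ⟨t, htD, ht⟩ := hD.isCompact.elim_nhds_subcover V
    fun x hx => (hV x hx).isOpen.mem_nhds (hxV x hx)
  refine ⟨⋃ x ∈ t, V x, t.finite_toSet.isClopen_biUnion fun x hx => hV x (htD x hx),
    isLowerSet_iUnion₂ fun x hx => hVlow x (htD x hx), ht, ?_⟩
  simpa using fun x hx => hyV x (htD x hx)

theorem isOpen_of_isClosed_of_isLowerSet [CompactSpace X]
    (hpriest : ∀ x y : X, ¬ y ≤ x →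
      ∃ U : Set X, IsClopen U ∧ IsLowerSet U ∧ x ∈ U ∧ y ∉ U)
    (hnoeth : ∀ C : ℕ → Set X, (∀ n, IsClosed (C n) ∧ IsLowerSet (C n)) →
      (∀ n, C (n + 1) ⊆ C n) → ∃ N, ∀ n ≥ N, C n = C N)
    {D : Set X} (hD : IsClosed D) (hlow : IsLowerSet D) : IsOpen D := by
  obtain ⟨⟨V, hVc, hVlow⟩, ⟨hV, hDV⟩, hmin⟩ := (wellFounded_closed_lowerSets hnoeth).has_min
    {C | IsOpen C.1 ∧ D ⊆ C.1} ⟨⟨univ, isClosed_univ, isLowerSet_univ⟩, isOpen_univ, subset_univ D⟩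
  suffices V ⊆ D by rwa [← this.antisymm hDV]
  by_contra hVD
  obtain ⟨y, hyV, hyD⟩ := not_subset.1 hVD
  obtain ⟨U, hU, hUlow, hDU, hyU⟩ := exists_isClopen_isLowerSet_superset hpriest hD hlow hyD
  refine hmin ⟨V ∩ U, hVc.inter hU.isClosed, hVlow.inter hUlow⟩
    ⟨hV.inter hU.isOpen, subset_inter hDV hDU⟩ ?_
  exact Subtype.mk_lt_mk.2 ⟨inter_subset_left, fun h => hyU (h hyV).2⟩

/-- Every nonempty subset of a Noetherian Priestley space has an isolated point. -/
theorem exists_isOpen_inter_eq_singleton [CompactSpace X]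
    (hpriest : ∀ x y : X, ¬ y ≤ x →
      ∃ U : Set X, IsClopen U ∧ IsLowerSet U ∧ x ∈ U ∧ y ∉ U)
    (hnoeth : ∀ C : ℕ → Set X, (∀ n, IsClosed (C n) ∧ IsLowerSet (C n)) →
      (∀ n, C (n + 1) ⊆ C n) → ∃ N, ∀ n ≥ N, C n = C N)
    {E : Set X} (hE : E.Nonempty) : ∃ (x : X) (V : Set X), IsOpen V ∧ V ∩ E = {x} := by
  obtain ⟨⟨D, hD, hlow⟩, ⟨x, hxD, hxE⟩, hmin⟩ := (wellFounded_closed_lowerSets hnoeth).has_min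
    {C | (C.1 ∩ E).Nonempty} ⟨⟨univ, isClosed_univ, isLowerSet_univ⟩, by simpa using hE⟩
  have hle : ∀ a ∈ D ∩ E, ∀ b ∈ D ∩ E, b ≤ a := by
    intro a ha b hb
    by_contra hba
    obtain ⟨U, hU, hUlow, haU, hbU⟩ := hpriest a b hba
    exact hmin ⟨D ∩ U, hD.inter hU.isClosed, hlow.inter hUlow⟩ ⟨a, ⟨ha.1, haU⟩, ha.2⟩
      (Subtype.mk_lt_mk.2 ⟨inter_subset_left, fun h => hbU (h hb.1).2⟩)
  refine ⟨x, D, isOpen_of_isClosed_of_isLowerSet hpriest hnoeth hD hlow, ?_⟩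
  refine Subset.antisymm (fun y hy => ?_) (singleton_subset_iff.2 ⟨hxD, hxE⟩)
  exact (hle x ⟨hxD, hxE⟩ y hy).antisymm (hle y hy x ⟨hxD, hxE⟩)

theorem totallySeparatedSpace_of_priestley
    (hpriest : ∀ x y : X, ¬ y ≤ x →
      ∃ U : Set X, IsClopen U ∧ IsLowerSet U ∧ x ∈ U ∧ y ∉ U) :
    TotallySeparatedSpace X := by
  rw [totallySeparatedSpace_iff_exists_isClopen]
  intro x y hxy
  by_cases h : y ≤ x
  · obtain ⟨U, hU, -, hyU, hxU⟩ := hpriest y x fun h' => hxy (h'.antisymm h)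
    exact ⟨Uᶜ, hU.compl, hxU, by simpa using hyU⟩
  · obtain ⟨U, hU, -, hxU, hyU⟩ := hpriest x y h
    exact ⟨U, hU, hxU, hyU⟩

end Priestley

/-! ### Scattered compact spaces do not map onto perfect spaces -/

universe u

theorem exists_isOpen_singleton_of_surjective {X Y : Type u} [TopologicalSpace X] [CompactSpace X]
    [TopologicalSpace Y] [T2Space Y] [Nonempty Y]
    (hscat : ∀ E : Set X, E.Nonempty → ∃ (x : X) (V : Set X), IsOpen V ∧ V ∩ E = {x})
    {p : X → Y} (hp : Continuous p) (hsurj : p.Surjective) : ∃ y : Y, IsOpen {y} := by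
  obtain ⟨E, _, hE, hmin⟩ := exists_compact_surjective_zorn_subset hp hsurj
  have hne : E.Nonempty := by
    rw [← image_nonempty (f := p), hE]
    exact univ_nonempty
  obtain ⟨x, V, hV, hVE⟩ := hscat E hne
  have hxE : x ∈ E := (hVE.symm ▸ mem_singleton x : x ∈ V ∩ E).2
  have hclosed : IsClosed ({⟨x, hxE⟩}ᶜ : Set E) := by
    rw [isClosed_compl_iff]
    convert hV.preimage (continuous_subtype_val (p := (· ∈ E))) using 1
    ext z
    have := Set.ext_iff.1 hVE z.1
    simp only [mem_inter_iff, z.2, and_true, mem_singleton_iff] at this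
    simp [Subtype.ext_iff, this]
  have himage := hmin {⟨x, hxE⟩}ᶜ (fun h => by simpa using Set.ext_iff.1 h ⟨x, hxE⟩) hclosed
  have hcont : Continuous (E.domRestrict p) := hp.comp continuous_subtype_val
  have himage_closed := (hclosed.isCompact.image hcont).isClosed
  refine ⟨p x, ?_⟩
  convert himage_closed.isOpen_compl using 1
  have hsub : (E.domRestrict p '' {⟨x, hxE⟩}ᶜ)ᶜ ⊆ {p x} := by
    intro y hy
    obtain ⟨z, hz, rfl⟩ : y ∈ p '' E := hE ▸ mem_univ y
    by_contra hne
    exact hy ⟨⟨z, hz⟩, fun h => hne (congrArg p (Subtype.ext_iff.1 h)), rfl⟩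
  exact ((nonempty_compl.2 himage).subset_singleton_iff.1 hsub).symm

theorem not_isOpen_singleton_pi_bool {ι : Type*} [Infinite ι] (y : ι → Bool) :
    ¬ IsOpen {y} := by
  classical
  intro hy
  have hlim : Tendsto (fun j => Function.update y j (!y j)) cofinite (nhds y) := by
    rw [tendsto_pi_nhds]
    intro i
    refine tendsto_const_nhds.congr' ?_
    filter_upwards [(finite_singleton i).compl_mem_cofinite] with j hj
    rw [Function.update_of_ne (Ne.symm hj)]
  obtain ⟨j, hj⟩ := (hlim.eventually (hy.mem_nhds rfl)).exists
  simpa using congrFun (mem_singleton_iff.1 hj) j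

/-! ### Infinite sets from dense finite sets -/

/-- In a hereditary family of finite sets of naturals that is stable under left translation,
sets of positive density yield sets whose initial segments are uniformly dense. -/
theorem exists_forall_le_card_filter_lt {P : Finset ℕ → Prop}
    (hmono : ∀ S T, P S → T ⊆ S → P T) (hshift : ∀ S m, P (S.map (addRightEmbedding m)) → P S)
    {K : ℕ} (hK : 0 < K)
    (hdense : ∀ M, ∃ (n : ℕ) (S : Finset ℕ), P S ∧ S ⊆ Finset.range n ∧ n + K * M < K * S.card)
    (N : ℕ) : ∃ S, P S ∧ ∀ i ≤ N, i ≤ (S.filter (· < K * i)).card := by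
  by_contra! hcon
  have hbound : ∀ n S, P S → S ⊆ Finset.range n → K * S.card ≤ n + K * N := by
    intro n
    induction n using Nat.strong_induction_on with
    | _ n ih =>
      intro S hS hSn
      obtain ⟨i, hiN, hi⟩ := hcon S hS
      have hsplit := Finset.card_filter_add_card_filter_not (s := S) (· < K * i)
      by_cases hin : K * i ≤ n
      · set R := S.filter (¬ · < K * i)
        have hmap : (R.image (· - K * i)).map (addRightEmbedding (K * i)) = R := by
          ext a
          simp only [Finset.mem_map, Finset.mem_image, addRightEmbedding_apply]
          constructor
          · rintro ⟨_, ⟨b, hb, rfl⟩, rfl⟩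
            rwa [Nat.sub_add_cancel (not_lt.1 (Finset.mem_filter.1 hb).2)]
          · exact fun ha => ⟨_, ⟨a, ha, rfl⟩,
              Nat.sub_add_cancel (not_lt.1 (Finset.mem_filter.1 ha).2)⟩
        have hpos : 0 < K * i := Nat.mul_pos hK (by omega)
        have hrec := ih (n - K * i) (by omega) (R.image (· - K * i))
          (hshift _ (K * i) (hmap.symm ▸ hmono S R hS (Finset.filter_subset _ _))) (by
            intro a ha
            obtain ⟨b, hb, rfl⟩ := Finset.mem_image.1 ha
            have hb' := Finset.mem_filter.1 hb
            have := Finset.mem_range.1 (hSn hb'.1)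
            exact Finset.mem_range.2 (by omega))
        rw [← Finset.card_map (addRightEmbedding (K * i)), hmap] at hrec
        have : K * (S.filter (· < K * i)).card ≤ K * i := Nat.mul_le_mul_left K hi.le
        rw [← hsplit, mul_add]
        omega
      · have hall : S.filter (· < K * i) = S := Finset.filter_true_of_mem fun a ha => by
          have := Finset.mem_range.1 (hSn ha)
          omega
        rw [hall] at hi
        exact (Nat.mul_le_mul_left K (hi.le.trans hiN)).trans (Nat.le_add_left _ _)
  obtain ⟨n, S, hS, hSn, hlt⟩ := hdense N
  exact absurd (hbound n S hS hSn) (not_le.2 hlt)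

theorem exists_infinite_forall_finset_subset {P : Finset ℕ → Prop}
    (hmono : ∀ S T, P S → T ⊆ S → P T) (hshift : ∀ S m, P (S.map (addRightEmbedding m)) → P S)
    {K : ℕ} (hK : 0 < K)
    (hdense : ∀ M, ∃ (n : ℕ) (S : Finset ℕ), P S ∧ S ⊆ Finset.range n ∧ n + K * M < K * S.card) :
    ∃ J : Set ℕ, J.Infinite ∧ ∀ S : Finset ℕ, ↑S ⊆ J → P S := by
  choose S hS hcard using exists_forall_le_card_filter_lt hmono hshift hK hdense
  let J : Set ℕ := {i | ∀ᶠ N in (hyperfilter ℕ : Filter ℕ), i ∈ S N}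
  refine ⟨J, fun hfin => ?_, fun T hT => ?_⟩
  · set i := hfin.toFinset.card + 1
    have hout : ∀ᶠ N in (hyperfilter ℕ : Filter ℕ),
        ∀ a ∈ Finset.range (K * i), a ∈ S N → a ∈ J := by
      rw [Filter.eventually_all_finset]
      intro a _
      by_cases ha : a ∈ J
      · exact Eventually.of_forall fun _ _ => ha
      · filter_upwards [Ultrafilter.eventually_not.2 ha] with N hN h using absurd h hN
    have hlarge : ∀ᶠ N in (hyperfilter ℕ : Filter ℕ), i ≤ N :=
      Nat.hyperfilter_le_atTop (eventually_ge_atTop i)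
    obtain ⟨N, hN, hiN⟩ := (hout.and hlarge).exists
    have hsub : (S N).filter (· < K * i) ⊆ hfin.toFinset := fun a ha => by
      obtain ⟨h₁, h₂⟩ := Finset.mem_filter.1 ha
      exact hfin.mem_toFinset.2 (hN a (Finset.mem_range.2 h₂) h₁)
    have := (hcard N i hiN).trans (Finset.card_le_card hsub)
    omega
  · obtain ⟨N, hN⟩ := ((Filter.eventually_all_finset T).2 fun a ha => hT ha).exists
    exact hmono (S N) T (hS N) hN

/-! ### Shattering along orbits -/

/-- The times in `S` are independent for the visits of orbits of `f` to `A`. -/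
def ShattersTimes (f : X → X) (A : Set X) (S : Finset ℕ) : Prop :=
  ∀ T ⊆ S, ∃ x, ∀ i ∈ S, f^[i] x ∈ A ↔ i ∈ T

theorem ShattersTimes.mono {f : X → X} {A : Set X} {S T : Finset ℕ} (hS : ShattersTimes f A S)
    (hTS : T ⊆ S) : ShattersTimes f A T := by
  intro R hR
  obtain ⟨x, hx⟩ := hS R (hR.trans hTS)
  exact ⟨x, fun i hi => hx i (hTS hi)⟩

theorem ShattersTimes.of_map_addRight {f : X → X} {A : Set X} {S : Finset ℕ} {m : ℕ}
    (hS : ShattersTimes f A (S.map (addRightEmbedding m))) : ShattersTimes f A S := by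
  intro T hT
  obtain ⟨x, hx⟩ := hS (T.map (addRightEmbedding m)) (Finset.map_subset_map.2 hT)
  refine ⟨f^[m] x, fun i hi => ?_⟩
  rw [← Function.iterate_add_apply]
  exact (hx (i + m) (Finset.mem_map_of_mem (addRightEmbedding m) hi)).trans
    (Finset.mem_map' (addRightEmbedding m))

/-- In a scattered compact space, the sets of times shattered by a clopen set have density zero. -/
theorem eventually_card_le_of_shattersTimes [TopologicalSpace X] [CompactSpace X]
    (hscat : ∀ E : Set X, E.Nonempty → ∃ (x : X) (V : Set X), IsOpen V ∧ V ∩ E = {x})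
    {f : X → X} (hf : Continuous f) {A : Set X} (hA : IsClopen A) {c : ℝ} (hc : 0 < c) :
    ∀ᶠ n : ℕ in atTop, ∀ S : Finset ℕ, ShattersTimes f A S → S ⊆ Finset.range n →
      (S.card : ℝ) ≤ c * n := by
  classical
  by_contra hcon
  have hfreq := not_eventually.1 hcon
  obtain ⟨K, hK⟩ := exists_nat_gt (2 / c)
  have hK0 : (0 : ℝ) < K := (by positivity : 0 < 2 / c).trans hK
  rw [div_lt_iff₀ hc] at hK
  obtain ⟨J, hJ, hJS⟩ := exists_infinite_forall_finset_subset (P := ShattersTimes f A)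
    (fun S T hS hTS => hS.mono hTS) (fun S m hS => hS.of_map_addRight) (Nat.cast_pos.1 hK0) (by
      intro M
      obtain ⟨n, hn, hnM⟩ := (hfreq.and_eventually (eventually_ge_atTop (K * M))).exists
      push Not at hn
      obtain ⟨S, hS, hSn, hlt⟩ := hn
      refine ⟨n, S, hS, hSn, ?_⟩
      have hnM' : (K * M : ℝ) ≤ n := by exact_mod_cast hnM
      have hn0 : (0 : ℝ) ≤ n := n.cast_nonneg
      have h₁ : (K : ℝ) * (c * n) < K * S.card := mul_lt_mul_of_pos_left hlt hK0
      have h₂ : 2 * (n : ℝ) ≤ K * c * n := mul_le_mul_of_nonneg_right hK.le hn0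
      have : (n + K * M : ℝ) < K * S.card := by nlinarith
      exact_mod_cast this)
  have := hJ.to_subtype
  let p : X → (ULift J → Bool) := fun x j => decide (f^[j.down] x ∈ A)
  have hclopen : ∀ (i : ℕ), IsClopen {x | f^[i] x ∈ A} := fun i => hA.preimage (hf.iterate i)
  have hp : Continuous p := continuous_pi fun j => by
    have : IsClopen {x | p x j = true} := by simpa [p] using hclopen j.down
    exact continuous_bool_rng true |>.2 this
  have hdense : DenseRange p := by
    intro y
    have happrox : ∀ F : Finset (ULift J), ∃ x, ∀ j ∈ F, p x j = y j := by
      intro F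
      obtain ⟨x, hx⟩ := hJS (F.image fun j => (j.down : ℕ))
        (by simpa [subset_def] using fun a ha _ => ha) ((F.filter (y · = true)).image fun j => (j.down : ℕ))
        (Finset.image_subset_image (Finset.filter_subset _ _))
      refine ⟨x, fun j hj => ?_⟩
      have hiff := hx j.down (Finset.mem_image_of_mem _ hj)
      have hmem : (j.down : ℕ) ∈ (F.filter (y · = true)).image (fun j => (j.down : ℕ)) ↔
          y j = true := by
        rw [Function.Injective.mem_finset_image
          (f := fun j : ULift J => (j.down : ℕ)) (Subtype.val_injective.comp ULift.down_injective)]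
        simp [hj]
      rw [Bool.eq_iff_iff, ← hmem, ← hiff]
      simp [p]
    choose x hx using happrox
    refine mem_closure_of_tendsto (tendsto_pi_nhds.2 fun j => tendsto_const_nhds.congr' ?_)
      (Eventually.of_forall fun F => mem_range_self (x F)) (b := atTop)
    filter_upwards [eventually_ge_atTop {j}] with F hF
    exact (hx F j (Finset.singleton_subset_iff.1 hF)).symm
  have hsurj : p.Surjective := by
    rw [← range_eq_univ, ← (isCompact_range hp).isClosed.closure_eq]
    exact hdense.closure_range
  obtain ⟨y, hy⟩ := exists_isOpen_singleton_of_surjective hscat hp hsurj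
  exact not_isOpen_singleton_pi_bool y hy

/-! ### Counting traces -/

open Classical in
/-- The visit patterns to `A` of orbit segments of length `n`. -/
noncomputable def traces (f : X → X) (A : Set X) (n : ℕ) : Finset (Finset (Fin n)) :=
  {T | ∃ x, ∀ i, i ∈ T ↔ f^[(i : ℕ)] x ∈ A}

theorem mem_traces {f : X → X} {A : Set X} {n : ℕ} {T : Finset (Fin n)} :
    T ∈ traces f A n ↔ ∃ x, ∀ i, i ∈ T ↔ f^[(i : ℕ)] x ∈ A := by
  simp [traces]

theorem shattersTimes_of_shatters {f : X → X} {A : Set X} {n : ℕ} {s : Finset (Fin n)}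
    (hs : (traces f A n).Shatters s) : ShattersTimes f A (s.map Fin.valEmbedding) := by
  intro T hT
  obtain ⟨t, ht, rfl⟩ := Finset.subset_map_iff.1 hT
  obtain ⟨u, hu, rfl⟩ := hs ht
  obtain ⟨x, hx⟩ := mem_traces.1 hu
  refine ⟨x, fun i hi => ?_⟩
  obtain ⟨j, hj, rfl⟩ := Finset.mem_map.1 hi
  rw [Finset.mem_map' Fin.valEmbedding, Finset.mem_inter, and_iff_right hj]
  exact (hx j).symm

/-- A family of subsets of an `n`-element set shattering only sets of size at most `d` has at most
`(1 + x)ⁿ / xᵈ` members, for `0 < x ≤ 1`. -/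
theorem card_mul_rpow_le {n : ℕ} {𝒜 : Finset (Finset (Fin n))} {d x : ℝ}
    (hd : ∀ s, 𝒜.Shatters s → (s.card : ℝ) ≤ d) (hx : 0 < x) (hx1 : x ≤ 1) :
    (𝒜.card : ℝ) * x ^ d ≤ (1 + x) ^ n := by
  calc (𝒜.card : ℝ) * x ^ d ≤ 𝒜.shatterer.card * x ^ d := by
        exact mul_le_mul_of_nonneg_right (mod_cast 𝒜.card_le_card_shatterer) (by positivity)
    _ = ∑ _s ∈ 𝒜.shatterer, x ^ d := by simp
    _ ≤ ∑ s ∈ 𝒜.shatterer, x ^ s.card := by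
        refine Finset.sum_le_sum fun s hs => ?_
        rw [← Real.rpow_natCast]
        exact Real.rpow_le_rpow_of_exponent_ge hx hx1 (hd s (Finset.mem_shatterer.1 hs))
    _ ≤ ∑ s : Finset (Fin n), x ^ s.card :=
        Finset.sum_le_sum_of_subset_of_nonneg (Finset.subset_univ _) fun _ _ _ => by positivity
    _ = (1 + x) ^ n := by
        simpa [add_comm] using Fintype.sum_pow_mul_eq_add_pow (Fin n) x 1

theorem tendsto_log_card_traces_div [TopologicalSpace X] [CompactSpace X]
    (hscat : ∀ E : Set X, E.Nonempty → ∃ (x : X) (V : Set X), IsOpen V ∧ V ∩ E = {x})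
    {f : X → X} (hf : Continuous f) {A : Set X} (hA : IsClopen A) :
    Tendsto (fun n : ℕ => Real.log (traces f A n).card / n) atTop (nhds 0) := by
  refine (Asymptotics.isLittleO_iff_tendsto' ?_).1 (Asymptotics.isLittleO_iff.2 ?_)
  · filter_upwards [eventually_gt_atTop 0] with n hn h
    exact absurd h (by positivity)
  intro ε hε
  obtain ⟨x, hx, hx1, hxε⟩ : ∃ x : ℝ, 0 < x ∧ x ≤ 1 ∧ x ≤ ε / 2 :=
    ⟨min 1 (ε / 2), by positivity, min_le_left _ _, min_le_right _ _⟩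
  have hlogx : Real.log x ≤ 0 := Real.log_nonpos hx.le hx1
  have hden : 0 < 1 - Real.log x := by linarith
  filter_upwards [eventually_card_le_of_shattersTimes hscat hf hA
    (c := ε / 2 / (1 - Real.log x)) (by positivity)] with n hn
  rw [Real.norm_of_nonneg (Real.log_natCast_nonneg _), Real.norm_of_nonneg n.cast_nonneg]
  rcases Nat.eq_zero_or_pos (traces f A n).card with h0 | h0
  · rw [h0]
    simp only [Nat.cast_zero, Real.log_zero]
    positivity
  have hcard : ∀ s, (traces f A n).Shatters s → (s.card : ℝ) ≤ ε / 2 / (1 - Real.log x) * n := by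
    intro s hs
    rw [← Finset.card_map Fin.valEmbedding]
    refine hn _ (shattersTimes_of_shatters hs) fun i hi => ?_
    obtain ⟨j, -, rfl⟩ := Finset.mem_map.1 hi
    exact Finset.mem_range.2 j.2
  have hbound := card_mul_rpow_le hcard hx hx1
  have h0' : (0 : ℝ) < (traces f A n).card := Nat.cast_pos.2 h0
  have hlog := Real.log_le_log (by positivity) hbound
  rw [Real.log_mul h0'.ne' (by positivity), Real.log_rpow hx, Real.log_pow] at hlog
  have h₁ : Real.log (1 + x) ≤ ε / 2 := by
    linarith [Real.log_le_sub_one_of_pos (by positivity : 0 < 1 + x)]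
  have h₂ : (n : ℝ) * Real.log (1 + x) ≤ n * (ε / 2) := by gcongr
  have h₃ : ε / 2 / (1 - Real.log x) * n * -Real.log x ≤ ε / 2 * n := by
    rw [div_mul_eq_mul_div, div_mul_eq_mul_div, div_le_iff₀ hden]
    exact mul_le_mul_of_nonneg_left (by linarith) (by positivity)
  linarith

/-- The complexity of a cover refined by a finite cover `V` is at most the product of the numbers
of visit patterns to the members of `V`. -/
theorem dynN_le_prod_card_traces {ι : Type*} [Fintype ι] (f : X → X) {U : Finset (Set X)}
    {V : ι → Set X} (hV : ⋃ a, V a = univ) (hVU : ∀ a, ∃ u ∈ U, V a ⊆ u) (n : ℕ) :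
    dynN f U n ≤ ∏ a, (traces f (V a) n).card := by
  classical
  choose u huU hVu using hVU
  let R : Finset (ι → Finset (Fin n)) :=
    (Fintype.piFinset fun a => traces f (V a) n).filter fun τ => ∀ i, ∃ a, i ∈ τ a
  have hR : ∀ τ : R, ∀ i, ∃ a, i ∈ τ.1 a := fun τ => (Finset.mem_filter.1 τ.2).2
  choose b hb using hR
  suffices h : dynN f U n ≤ R.card from
    h.trans ((Finset.card_filter_le _ _).trans (Fintype.card_piFinset _).le)
  refine Nat.sInf_le ⟨fun j i => u (b (R.equivFin.symm j) i), fun j i => huU _, ?_⟩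
  refine eq_univ_of_forall fun x => mem_iUnion.2 ?_
  let τ : ι → Finset (Fin n) := fun a => {i | f^[(i : ℕ)] x ∈ V a}
  have hτ : τ ∈ R := by
    refine Finset.mem_filter.2 ⟨Fintype.mem_piFinset.2 fun a => mem_traces.2 ⟨x, by simp [τ]⟩,
      fun i => ?_⟩
    obtain ⟨a, ha⟩ := mem_iUnion.1 (hV ▸ mem_univ (f^[(i : ℕ)] x) : f^[(i : ℕ)] x ∈ ⋃ a, V a)
    exact ⟨a, by simpa [τ] using ha⟩
  refine ⟨R.equivFin ⟨τ, hτ⟩, mem_iInter.2 fun i => ?_⟩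
  change f^[(i : ℕ)] x ∈ u (b (R.equivFin.symm (R.equivFin ⟨τ, hτ⟩)) i)
  rw [Equiv.symm_apply_apply]
  exact hVu _ (by simpa [τ] using hb ⟨τ, hτ⟩ i)

theorem log_dynN_le_sum {ι : Type*} [Fintype ι] (f : X → X) {U : Finset (Set X)}
    {V : ι → Set X} (hV : ⋃ a, V a = univ) (hVU : ∀ a, ∃ u ∈ U, V a ⊆ u) (n : ℕ) :
    Real.log (dynN f U n) ≤ ∑ a, Real.log (traces f (V a) n).card := by
  have hle := dynN_le_prod_card_traces f hV hVU n
  rcases Nat.eq_zero_or_pos (dynN f U n) with h0 | h0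
  · rw [h0, Nat.cast_zero, Real.log_zero]
    exact Finset.sum_nonneg fun a _ => Real.log_natCast_nonneg _
  · have hne : ∀ a ∈ Finset.univ, ((traces f (V a) n).card : ℝ) ≠ 0 := fun a ha =>
      Nat.cast_ne_zero.2 (Finset.prod_ne_zero_iff.1 (h0.trans_le hle).ne' a ha)
    rw [← Real.log_prod hne]
    exact Real.log_le_log (Nat.cast_pos.2 h0) (by exact_mod_cast hle)

/-- An open cover of a compact totally separated space is refined by a finite clopen cover. -/
theorem exists_finset_isClopen_refinement [TopologicalSpace X] [CompactSpace X]
    [TotallySeparatedSpace X] {U : Finset (Set X)} (hU : ∀ u ∈ U, IsOpen u)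
    (hcov : ⋃₀ (U : Set (Set X)) = univ) :
    ∃ (t : Finset X) (V : t → Set X), (∀ a, IsClopen (V a)) ∧ ⋃ a, V a = univ ∧
      ∀ a, ∃ u ∈ U, V a ⊆ u := by
  have hloc : ∀ x : X, ∃ V : Set X, IsClopen V ∧ x ∈ V ∧ ∃ u ∈ U, V ⊆ u := by
    intro x
    obtain ⟨u, hu, hxu⟩ := mem_sUnion.1 (hcov ▸ mem_univ x : x ∈ ⋃₀ (U : Set (Set X)))
    obtain ⟨V, hV, hxV, hVu⟩ := compact_exists_isClopen_in_isOpen (hU u hu) hxu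
    exact ⟨V, hV, hxV, u, hu, hVu⟩
  choose V hV hxV hVU using hloc
  obtain ⟨t, ht⟩ := CompactSpace.elim_nhds_subcover V fun x => (hV x).isOpen.mem_nhds (hxV x)
  refine ⟨t, fun a => V a, fun a => hV a, ?_, fun a => hVU a⟩
  rw [iUnion_subtype]
  exact ht

theorem coverEntropy_eq_zero_of_scattered [TopologicalSpace X] [CompactSpace X]
    [TotallySeparatedSpace X]
    (hscat : ∀ E : Set X, E.Nonempty → ∃ (x : X) (V : Set X), IsOpen V ∧ V ∩ E = {x})
    {f : X → X} (hf : Continuous f) : coverEntropy f = 0 := by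
  refine le_antisymm (iSup_le fun U => iSup₂_le fun hU hcov => ?_) zero_le
  obtain ⟨t, V, hV, hVcov, hVU⟩ := exists_finset_isClopen_refinement hU hcov
  have hsum : Tendsto (fun n : ℕ => ∑ a, Real.log (traces f (V a) n).card / n) atTop (nhds 0) := by
    simpa using tendsto_finsetSum Finset.univ fun a _ => tendsto_log_card_traces_div hscat hf (hV a)
  have hlim : Tendsto (fun n : ℕ => ENNReal.ofReal (∑ a, Real.log (traces f (V a) n).card / n))
      atTop (nhds 0) := by
    simpa using ENNReal.tendsto_ofReal hsum
  rw [← hlim.limsup_eq]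
  refine limsup_le_limsup ?_
  filter_upwards [eventually_gt_atTop 0] with n hn
  rw [← ENNReal.ofReal_natCast, ← ENNReal.ofReal_div_of_pos (Nat.cast_pos.2 hn), ← Finset.sum_div]
  exact ENNReal.ofReal_le_ofReal
    (div_le_div_of_nonneg_right (log_dynN_le_sum f hVcov hVU n) n.cast_nonneg)

/-- Any continuous self-map of a Noetherian Priestley space has zero topological
entropy. -/
theorem stmt8 [TopologicalSpace X] [PartialOrder X] [CompactSpace X]
    (hpriest : ∀ x y : X, ¬ y ≤ x →
      ∃ U : Set X, IsClopen U ∧ IsLowerSet U ∧ x ∈ U ∧ y ∉ U)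
    (hnoeth : ∀ C : ℕ → Set X, (∀ n, IsClosed (C n) ∧ IsLowerSet (C n)) →
      (∀ n, C (n + 1) ⊆ C n) → ∃ N, ∀ n ≥ N, C n = C N)
    (f : X → X) (hf : Continuous f) :
    coverEntropy f = 0 := by
  have := totallySeparatedSpace_of_priestley hpriest
  exact coverEntropy_eq_zero_of_scattered
    (fun _ hE => exists_isOpen_inter_eq_singleton hpriest hnoeth hE) hf
end

section
/- Let (Aᵢ, σᵢⱼ) be a directed system of commutative rings with unit and A = injlim Aᵢ. Then the map sending a proper ideal 𝔄 of A to the family (σᵢ⁻¹(𝔄))ᵢ is a homeomorphism Id(A) ≅ projlim Id(Aᵢ), where each ideal space carries its constructible topology. -/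
open Set

/-- The set `Id(R)` of proper ideals of `R`. -/
def ProperIdeal (R : Type*) [CommRing R] : Type _ := {I : Ideal R // I ≠ ⊤}

/-- The characteristic-function embedding `Id(R) → {0,1}^R`. -/
noncomputable def idealChi (R : Type*) [CommRing R] : ProperIdeal R → (R → Bool) :=
  fun I a => @decide (a ∈ I.1) (Classical.propDecidable _)

/-- The constructible topology on `Id(R)`. -/
noncomputable def conTop (R : Type*) [CommRing R] : TopologicalSpace (ProperIdeal R) :=
  TopologicalSpace.induced (idealChi R) inferInstance

/-- The projective limit `projlim Id(Aᵢ)` along the maps `𝔄 ↦ σᵢⱼ⁻¹(𝔄)`. -/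
abbrev ProjLimIdeal {ι : Type*} [Preorder ι] (As : ι → Type*) [∀ i, CommRing (As i)]
    (σij : ∀ i j : ι, i ≤ j → As i →+* As j) : Type _ :=
  {u : ∀ i, ProperIdeal (As i) //
    ∀ (i j : ι) (h : i ≤ j), Ideal.comap (σij i j h) (u j).1 = (u i).1}

/-- The topology on `projlim Id(Aᵢ)` induced by the product of the constructible
topologies. -/
noncomputable def projLimTop {ι : Type*} [Preorder ι] (As : ι → Type*)
    [∀ i, CommRing (As i)] (σij : ∀ i j : ι, i ≤ j → As i →+* As j) :
    TopologicalSpace (ProjLimIdeal As σij) :=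
  TopologicalSpace.induced (fun u => u.1)
    (@Pi.topologicalSpace ι (fun i => ProperIdeal (As i)) (fun i => conTop (As i)))

theorem continuous_conTop_iff {X R : Type*} [TopologicalSpace X] [CommRing R]
    {f : X → ProperIdeal R} :
    @Continuous X (ProperIdeal R) _ (conTop R) f ↔
      ∀ a, Continuous fun x => idealChi R (f x) a := by
  rw [conTop, continuous_induced_rng, continuous_pi_iff]
  rfl

theorem continuous_idealChi_apply {R : Type*} [CommRing R] (a : R) :
    @Continuous (ProperIdeal R) Bool (conTop R) _ fun I => idealChi R I a :=
  letI := conTop R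
  continuous_conTop_iff.1 continuous_id a

theorem idealChi_eq_idealChi {R S : Type*} [CommRing R] [CommRing S] {I : ProperIdeal R}
    {J : ProperIdeal S} {a : R} {b : S} (h : a ∈ I.1 ↔ b ∈ J.1) :
    idealChi R I a = idealChi S J b := by
  unfold idealChi
  exact decide_eq_decide.2 h

/-- The preimage of a proper ideal under a ring homomorphism. -/
def ProperIdeal.comap {R S : Type*} [CommRing R] [CommRing S] (f : R →+* S)
    (I : ProperIdeal S) : ProperIdeal R :=
  ⟨Ideal.comap f I.1, Ideal.comap_ne_top f I.2⟩

section DirectLimit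

variable {ι : Type*} [Preorder ι] [IsDirected ι (· ≤ ·)]
  {As : ι → Type*} [∀ i, CommRing (As i)] {σij : ∀ i j : ι, i ≤ j → As i →+* As j}
  {A : Type*} [CommRing A] (σ : ∀ i, As i →+* A)

/-- Membership in a compatible family of ideals depends only on the image in the limit. -/
theorem ProjLimIdeal.mem_iff_of_map_eq
    (hσ : ∀ (i j : ι) (h : i ≤ j) (x : As i), σ j (σij i j h x) = σ i x)
    (hker : ∀ (i : ι) (x y : As i), σ i x = σ i y →
      ∃ (j : ι) (h : i ≤ j), σij i j h x = σij i j h y)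
    (u : ProjLimIdeal As σij) {i j : ι} {x : As i} {y : As j} (hxy : σ i x = σ j y) :
    x ∈ (u.1 i).1 ↔ y ∈ (u.1 j).1 := by
  obtain ⟨k, hik, hjk⟩ := exists_ge_ge i j
  obtain ⟨l, hkl, hl⟩ := hker k (σij i k hik x) (σij j k hjk y) (by rw [hσ, hσ, hxy])
  rw [← u.2 i k hik, ← u.2 j k hjk, Ideal.mem_comap, Ideal.mem_comap, ← u.2 k l hkl,
    Ideal.mem_comap, Ideal.mem_comap, hl]

/-- The ideal `⋃ᵢ σᵢ(𝔄ᵢ)` of the direct limit defined by a compatible family `(𝔄ᵢ)`. -/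
def ProjLimIdeal.unionIdeal [Nonempty ι]
    (hσ : ∀ (i j : ι) (h : i ≤ j) (x : As i), σ j (σij i j h x) = σ i x)
    (hsurj : ∀ a : A, ∃ (i : ι) (x : As i), σ i x = a)
    (u : ProjLimIdeal As σij) : Ideal A where
  carrier := {a | ∃ (i : ι) (x : As i), x ∈ (u.1 i).1 ∧ σ i x = a}
  zero_mem' := ⟨Classical.arbitrary ι, 0, zero_mem _, map_zero _⟩
  add_mem' := by
    rintro _ _ ⟨i, x, hx, rfl⟩ ⟨j, y, hy, rfl⟩
    obtain ⟨k, hik, hjk⟩ := exists_ge_ge i j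
    rw [← u.2 i k hik] at hx
    rw [← u.2 j k hjk] at hy
    exact ⟨k, σij i k hik x + σij j k hjk y, add_mem hx hy, by rw [map_add, hσ, hσ]⟩
  smul_mem' := by
    rintro c _ ⟨j, y, hy, rfl⟩
    obtain ⟨i, x, rfl⟩ := hsurj c
    obtain ⟨k, hik, hjk⟩ := exists_ge_ge i j
    rw [← u.2 j k hjk] at hy
    exact ⟨k, σij i k hik x * σij j k hjk y, Ideal.mul_mem_left _ _ hy, by
      rw [map_mul, hσ, hσ, smul_eq_mul]⟩

theorem ProjLimIdeal.map_mem_unionIdeal_iff [Nonempty ι]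
    (hσ : ∀ (i j : ι) (h : i ≤ j) (x : As i), σ j (σij i j h x) = σ i x)
    (hsurj : ∀ a : A, ∃ (i : ι) (x : As i), σ i x = a)
    (hker : ∀ (i : ι) (x y : As i), σ i x = σ i y →
      ∃ (j : ι) (h : i ≤ j), σij i j h x = σij i j h y)
    (u : ProjLimIdeal As σij) {i : ι} {x : As i} :
    σ i x ∈ ProjLimIdeal.unionIdeal σ hσ hsurj u ↔ x ∈ (u.1 i).1 :=
  ⟨fun ⟨_, _, hy, hyx⟩ => (ProjLimIdeal.mem_iff_of_map_eq σ hσ hker u hyx).1 hy,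
    fun hx => ⟨i, x, hx, rfl⟩⟩

theorem ProjLimIdeal.unionIdeal_ne_top [Nonempty ι]
    (hσ : ∀ (i j : ι) (h : i ≤ j) (x : As i), σ j (σij i j h x) = σ i x)
    (hsurj : ∀ a : A, ∃ (i : ι) (x : As i), σ i x = a)
    (hker : ∀ (i : ι) (x y : As i), σ i x = σ i y →
      ∃ (j : ι) (h : i ≤ j), σij i j h x = σij i j h y)
    (u : ProjLimIdeal As σij) : ProjLimIdeal.unionIdeal σ hσ hsurj u ≠ ⊤ := by
  have i := Classical.arbitrary ι
  rw [Ideal.ne_top_iff_one, ← map_one (σ i),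
    ProjLimIdeal.map_mem_unionIdeal_iff σ hσ hsurj hker, ← Ideal.ne_top_iff_one]
  exact (u.1 i).2

/-- Proper ideals of a direct limit correspond to compatible families of proper ideals. -/
def properIdealEquivProjLim [Nonempty ι]
    (hσ : ∀ (i j : ι) (h : i ≤ j) (x : As i), σ j (σij i j h x) = σ i x)
    (hsurj : ∀ a : A, ∃ (i : ι) (x : As i), σ i x = a)
    (hker : ∀ (i : ι) (x y : As i), σ i x = σ i y →
      ∃ (j : ι) (h : i ≤ j), σij i j h x = σij i j h y) :
    ProperIdeal A ≃ ProjLimIdeal As σij where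
  toFun I := ⟨fun i => I.comap (σ i), fun i j h => by
    ext x
    simp only [ProperIdeal.comap, Ideal.mem_comap, hσ]⟩
  invFun u := ⟨ProjLimIdeal.unionIdeal σ hσ hsurj u,
    ProjLimIdeal.unionIdeal_ne_top σ hσ hsurj hker u⟩
  left_inv I := by
    refine Subtype.ext (Ideal.ext fun a => ?_)
    obtain ⟨i, x, rfl⟩ := hsurj a
    exact ProjLimIdeal.map_mem_unionIdeal_iff σ hσ hsurj hker _
  right_inv u := Subtype.ext <| funext fun _ => Subtype.ext <| Ideal.ext fun _ =>
    ProjLimIdeal.map_mem_unionIdeal_iff σ hσ hsurj hker u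

end DirectLimit

/-- For a directed system of commutative rings `(Aᵢ, σᵢⱼ)` with direct limit `A`
(expressed by the maps `σᵢ : Aᵢ → A` being compatible, jointly surjective, and with the
usual kernel condition), the map `𝔄 ↦ (σᵢ⁻¹(𝔄))ᵢ` is a homeomorphism
`Id(A) ≅ projlim Id(Aᵢ)` for the constructible topologies. -/
theorem stmt16 {ι : Type*} [Preorder ι] [IsDirected ι (· ≤ ·)] [Nonempty ι]
    (As : ι → Type*) [∀ i, CommRing (As i)]
    (σij : ∀ i j : ι, i ≤ j → As i →+* As j)
    (hid : ∀ i (x : As i), σij i i le_rfl x = x)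
    (hcomp : ∀ (i j l : ι) (hij : i ≤ j) (hjl : j ≤ l) (x : As i),
      σij j l hjl (σij i j hij x) = σij i l (hij.trans hjl) x)
    (A : Type*) [CommRing A] (σ : ∀ i, As i →+* A)
    (hσ : ∀ (i j : ι) (h : i ≤ j) (x : As i), σ j (σij i j h x) = σ i x)
    (hsurj : ∀ a : A, ∃ (i : ι) (x : As i), σ i x = a)
    (hker : ∀ (i : ι) (x y : As i), σ i x = σ i y →
      ∃ (j : ι) (h : i ≤ j), σij i j h x = σij i j h y) :
    ∃ e : @Homeomorph (ProperIdeal A) (ProjLimIdeal As σij)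
        (conTop A) (projLimTop As σij),
      ∀ (I : ProperIdeal A) (i : ι), ((e I).1 i).1 = Ideal.comap (σ i) I.1 := by
  let := conTop A
  let : ∀ i, TopologicalSpace (ProperIdeal (As i)) := fun i => conTop (As i)
  let := projLimTop As σij
  refine ⟨⟨properIdealEquivProjLim σ hσ hsurj hker, ?_, ?_⟩, fun I i => rfl⟩
  · refine continuous_induced_rng.2 (continuous_pi fun i => continuous_conTop_iff.2 fun x => ?_)
    exact continuous_idealChi_apply (σ i x)
  · refine continuous_conTop_iff.2 fun a => ?_
    obtain ⟨i, x, rfl⟩ := hsurj a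
    have h : Continuous fun u : ProjLimIdeal As σij => idealChi (As i) (u.1 i) x :=
      (continuous_idealChi_apply x).comp ((continuous_apply i).comp continuous_induced_dom)
    exact h.congr fun u => idealChi_eq_idealChi
      (ProjLimIdeal.map_mem_unionIdeal_iff σ hσ hsurj hker u).symm
end

section
/- Let R be a commutative ring with unit and f₁, …, f_m ∈ R non-nilpotent elements generating the unit ideal. Then every primary ideal I of R lies in the image of res : Id(R[fᵢ⁻¹]) → Id(R) for at least one i. Consequently the sets res(Prim(R[fᵢ⁻¹])) cover Prim(R), the closure (in the constructible topology on Id(R)) of the set of primary ideals. -/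
open Set

/-- `Prim(R)`: the closure, for the constructible topology, of the set of primary
ideals in `Id(R)`. -/
noncomputable def PrimClos (R : Type*) [CommRing R] : Set (ProperIdeal R) :=
  @closure (ProperIdeal R) (conTop R) {I : ProperIdeal R | I.1.IsPrimary}

/-- The restriction map `res : Id(R[g⁻¹]) → Id(R)`, `J ↦ J ∩ R`. -/
def resMap (R : Type*) [CommRing R] (g : R) :
    ProperIdeal (Localization.Away g) → ProperIdeal R :=
  fun J => ⟨Ideal.comap (algebraMap R (Localization.Away g)) J.1,
    Ideal.comap_ne_top _ J.2⟩

lemma isPrimary_of_comap_algebraMap {R S : Type*} [CommRing R] [CommRing S] [Algebra R S]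
    (M : Submonoid R) [IsLocalization M S] {J : Ideal S}
    (h : (J.comap (algebraMap R S)).IsPrimary) : J.IsPrimary := by
  rw [Ideal.isPrimary_iff] at h ⊢
  refine ⟨fun hJ => h.1 (by rw [hJ, Ideal.comap_top]), fun {x y} hxy => ?_⟩
  obtain ⟨a, s, rfl⟩ := IsLocalization.exists_mk'_eq M x
  obtain ⟨b, t, rfl⟩ := IsLocalization.exists_mk'_eq M y
  rw [← IsLocalization.mk'_mul, IsLocalization.mk'_mem_iff] at hxy
  rw [IsLocalization.mk'_mem_iff, IsLocalization.mk'_mem_iff]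
  rcases h.2 (x := a) (y := b) hxy with ha | hb
  · exact Or.inl ha
  · rw [← Ideal.comap_radical] at hb
    exact Or.inr hb

/-- An ideal modulo which `g` is a nonzerodivisor is contracted from `R[g⁻¹]`. -/
lemma comap_map_away_eq {R : Type*} [CommRing R] (g : R) (I : Ideal R)
    (h : ∀ a, g * a ∈ I → a ∈ I) :
    (I.map (algebraMap R (Localization.Away g))).comap
      (algebraMap R (Localization.Away g)) = I := by
  refine le_antisymm (fun a ha => ?_) Ideal.le_comap_map
  obtain ⟨_, ⟨n, rfl⟩, hs⟩ := (IsLocalization.algebraMap_mem_map_algebraMap_iff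
    (Submonoid.powers g) (Localization.Away g) I a).1 ha
  replace hs : g ^ n * a ∈ I := by simpa using hs
  induction n with
  | zero => simpa using hs
  | succ n ih => exact ih (h _ (by rwa [← mul_assoc, ← pow_succ']))

/-- A primary ideal is saturated with respect to some member of a family generating the
unit ideal. -/
lemma Ideal.IsPrimary.exists_mul_mem_imp {R ι : Type*} [CommRing R] {f : ι → R}
    (hgen : Ideal.span (Set.range f) = ⊤) {I : Ideal R} (hI : I.IsPrimary) :
    ∃ i, ∀ a, f i * a ∈ I → a ∈ I := by
  rw [Ideal.isPrimary_iff] at hI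
  have : ∃ i, f i ∉ I.radical := by
    by_contra! hc
    refine hI.1 (Ideal.radical_eq_top.1 (top_le_iff.1 ?_))
    rw [← hgen, Ideal.span_le]
    rintro _ ⟨i, rfl⟩
    exact hc i
  obtain ⟨i, hi⟩ := this
  exact ⟨i, fun a ha => (hI.2 (by rwa [mul_comm] at ha)).resolve_right hi⟩

/-- An ideal modulo which `g` is a nonzerodivisor is the image of a proper ideal of
`R[g⁻¹]`. -/
lemma exists_resMap_eq {R : Type*} [CommRing R] (g : R) (I : ProperIdeal R)
    (h : ∀ a, g * a ∈ I.1 → a ∈ I.1) : ∃ J, resMap R g J = I := by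
  have hc := comap_map_away_eq g I.1 h
  refine ⟨⟨I.1.map (algebraMap R (Localization.Away g)), fun hJ => I.2 ?_⟩, Subtype.ext hc⟩
  rw [← hc, hJ, Ideal.comap_top]

lemma idealChi_eq_true_iff {R : Type*} [CommRing R] (I : ProperIdeal R) (a : R) :
    idealChi R I a = true ↔ a ∈ I.1 := by
  simp [idealChi]

/-- The constructible topology on `Id(R[g⁻¹])` is coarser than the one induced from `Id(R)`. -/
lemma induced_resMap_le {R : Type*} [CommRing R] (g : R) :
    (conTop R).induced (resMap R g) ≤ conTop (Localization.Away g) := by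
  let num : Localization.Away g → R := fun x => (IsLocalization.sec (Submonoid.powers g) x).1
  have key : idealChi (Localization.Away g) =
      (fun φ : R → Bool => φ ∘ num) ∘ idealChi R ∘ resMap R g := by
    funext J x
    rw [Bool.eq_iff_iff, idealChi_eq_true_iff]
    refine Iff.trans ?_ (idealChi_eq_true_iff (resMap R g J) (num x)).symm
    conv_lhs => rw [← IsLocalization.mk'_sec (M := Submonoid.powers g) (Localization.Away g) x]
    exact IsLocalization.mk'_mem_iff
  have hcont : Continuous (fun φ : R → Bool => φ ∘ num) :=
    continuous_pi fun x => continuous_apply (num x)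
  unfold conTop
  rw [key, ← induced_compose, induced_compose]
  exact induced_mono hcont.le_induced

lemma isClosed_setOf_mul_mem_imp {R : Type*} [CommRing R] (g : R) :
    @IsClosed _ (conTop R) {I : ProperIdeal R | ∀ a, g * a ∈ I.1 → a ∈ I.1} := by
  let := conTop R
  have hchi : Continuous (idealChi R) := continuous_induced_dom
  have hev (a : R) : Continuous fun I : ProperIdeal R => idealChi R I a :=
    (continuous_apply a).comp hchi
  have hcl (a : R) : IsClopen {I : ProperIdeal R | a ∈ I.1} := by
    simpa only [Set.preimage, Set.mem_singleton_iff, idealChi_eq_true_iff] using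
      (isClopen_discrete {true}).preimage (hev a)
  simp only [Set.ofPred_forall]
  exact isClosed_iInter fun a => isClosed_imp (hcl (g * a)).isOpen (hcl a).isClosed

/-- The constructible closure of the primary ideals modulo which `g` is a nonzerodivisor is
contained in the image of `Prim(R[g⁻¹])`. -/
lemma closure_subset_image_primClos {R : Type*} [CommRing R] (g : R) :
    @closure _ (conTop R)
      {I : ProperIdeal R | I.1.IsPrimary ∧ ∀ a, g * a ∈ I.1 → a ∈ I.1} ⊆
      resMap R g '' PrimClos (Localization.Away g) := by
  intro I hI
  let := conTop R
  have hsat := closure_minimal (fun _ h => h.2) (isClosed_setOf_mul_mem_imp g) hI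
  obtain ⟨J, rfl⟩ := exists_resMap_eq g I hsat
  refine ⟨J, ?_, rfl⟩
  refine closure.mono (induced_resMap_le g) (closure_induced.2 (closure_mono ?_ hI))
  rintro K ⟨hK, hKs⟩
  obtain ⟨L, rfl⟩ := exists_resMap_eq g K hKs
  exact ⟨L, isPrimary_of_comap_algebraMap (Submonoid.powers g) hK, rfl⟩

/-- If `f₁, …, f_m` are non-nilpotent and generate the unit ideal, then every primary
ideal of `R` is in the image of `res : Id(R[fᵢ⁻¹]) → Id(R)` for some `i`; consequently
the sets `res(Prim(R[fᵢ⁻¹]))` cover `Prim(R)`, the constructible closure of the set of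
primary ideals. -/
theorem stmt18 (R : Type*) [CommRing R] (m : ℕ) (f : Fin m → R)
    (hnil : ∀ i, ¬ IsNilpotent (f i))
    (hgen : Ideal.span (Set.range f) = ⊤) :
    (∀ I : Ideal R, I.IsPrimary → ∃ (i : Fin m) (J : Ideal (Localization.Away (f i))),
      J ≠ ⊤ ∧ Ideal.comap (algebraMap R (Localization.Away (f i))) J = I) ∧
    PrimClos R ⊆ ⋃ i : Fin m, resMap R (f i) '' PrimClos (Localization.Away (f i)) := by
  refine ⟨fun I hI => ?_, ?_⟩
  · obtain ⟨i, hi⟩ := hI.exists_mul_mem_imp hgen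
    obtain ⟨J, hJ⟩ := exists_resMap_eq (f i) ⟨I, (Ideal.isPrimary_iff.1 hI).1⟩ hi
    exact ⟨i, J.1, J.2, congrArg Subtype.val hJ⟩
  · let := conTop R
    have hcover : {I : ProperIdeal R | I.1.IsPrimary} ⊆
        ⋃ i, {I : ProperIdeal R | I.1.IsPrimary ∧ ∀ a, f i * a ∈ I.1 → a ∈ I.1} := by
      intro I hI
      obtain ⟨i, hi⟩ := Ideal.IsPrimary.exists_mul_mem_imp hgen hI
      exact Set.mem_iUnion.2 ⟨i, hI, hi⟩
    refine (closure_mono hcover).trans ?_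
    rw [closure_iUnion_of_finite]
    exact Set.iUnion_mono fun i => closure_subset_image_primClos (f i)
end
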